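/- arXiv:2409.08470 — 4 statements merged into one kernel-verified Lean document; each statement's English description precedes it below -/
import Mathlib

section
/- Let n ≥ 1, let 0 < r < R, let I ⊆ ℝ be an open interval, and let k be a natural number. Write B = {z ∈ ℂⁿ : ‖z‖ < R} and A = {z ∈ ℂⁿ : r < ‖z‖ < R}. Suppose h : I × B → ℂ is such that for each t ∈ I the map z ↦ h(t,z) is holomorphic on B, and the restriction of h to I × A is C^k (k times continuously differentiable jointly in (t,z) in the real sense). Then h is C^k on all of I × B. -/
open Set Metric

universe u

/-- A parametric interval integral of a jointly `C^k` function is `C^k` in the parameter. -/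
theorem contDiffOn_parametric_intervalIntegral {E : Type u} [NormedAddCommGroup E]
    [NormedSpace ℝ E] [LocallyCompactSpace E] {U : Set E} (hU : IsOpen U) (a b : ℝ) (k : ℕ) :
    ∀ {F : Type u} [NormedAddCommGroup F] [NormedSpace ℝ F] {f : E × ℝ → F},
      ContDiffOn ℝ k f (U ×ˢ univ) →
        ContDiffOn ℝ k (fun x => ∫ θ in a..b, f (x, θ)) U := by
  induction k with
  | zero =>
    intro F _ _ f hf
    have hf' := hf.continuousOn
    rw [Nat.cast_zero, contDiffOn_zero, continuousOn_iff_continuous_domRestrict]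
    have : LocallyCompactSpace U := hU.locallyCompactSpace
    refine intervalIntegral.continuous_parametric_intervalIntegral_of_continuous'
      (f := fun (x : U) θ => f (x, θ)) ?_ a b
    exact hf'.comp_continuous (by fun_prop) fun p => ⟨p.1.2, mem_univ _⟩
  | succ k ih =>
    intro F _ _ f hf
    have hO : IsOpen (U ×ˢ (univ : Set ℝ)) := hU.prod isOpen_univ
    set G : E × ℝ → E →L[ℝ] F :=
      fun p => (fderiv ℝ f p).comp (ContinuousLinearMap.inl ℝ E ℝ)
    have hGk : ContDiffOn ℝ k G (U ×ˢ univ) :=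
      (hf.fderiv_of_isOpen hO (by simp)).clm_comp contDiffOn_const
    have hslice : ∀ x ∈ U, Continuous fun θ : ℝ => f (x, θ) := fun x hx =>
      hf.continuousOn.comp_continuous (by fun_prop) fun _ => ⟨hx, mem_univ _⟩
    have hder : ∀ x ∈ U, HasFDerivAt (fun x => ∫ θ in a..b, f (x, θ))
        (∫ θ in a..b, G (x, θ)) x := by
      intro x hx
      obtain ⟨K, hKx, hKU, hK⟩ := local_compact_nhds (hU.mem_nhds hx)
      obtain ⟨C, hC⟩ := (hK.prod (isCompact_uIcc (a := a) (b := b))).exists_bound_of_continuousOn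
        (hGk.continuousOn.mono (prod_mono hKU (subset_univ _)))
      refine intervalIntegral.hasFDerivAt_integral_of_dominated_of_fderiv_le (bound := fun _ => C)
        (F' := fun x θ => G (x, θ)) hKx ?_ ((hslice x hx).intervalIntegrable _ _) ?_ ?_
        intervalIntegrable_const ?_
      · filter_upwards [hU.mem_nhds hx] with y hy
        exact (hslice y hy).aestronglyMeasurable
      · exact (hGk.continuousOn.comp_continuous (f := fun θ : ℝ => (x, θ)) (by fun_prop)
          fun _ => ⟨hx, mem_univ _⟩).aestronglyMeasurable
      · exact .of_forall fun θ hθ y hy => hC (y, θ) ⟨hy, uIoc_subset_uIcc hθ⟩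
      · refine .of_forall fun θ _ y hy => ?_
        have hd : DifferentiableAt ℝ f (y, θ) :=
          (hf.differentiableOn (by simp)).differentiableAt (hO.mem_nhds ⟨hKU hy, mem_univ _⟩)
        exact hd.hasFDerivAt.comp y (hasFDerivAt_prodMk_left y θ)
    rw [Nat.cast_succ, contDiffOn_succ_iff_fderiv_of_isOpen hU]
    exact ⟨fun x hx => (hder x hx).differentiableAt.differentiableWithinAt, by simp,
      (ih hGk).congr fun x hx => (hder x hx).fderiv⟩

/-- Every vector of a nontrivial complex normed space is a complex multiple of a unit vector. -/
theorem exists_norm_eq_one_smul_eq {V : Type*} [NormedAddCommGroup V] [NormedSpace ℂ V]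
    [Nontrivial V] (z : V) : ∃ (e : V) (c : ℂ), ‖e‖ = 1 ∧ ‖c‖ = ‖z‖ ∧ c • e = z := by
  rcases eq_or_ne z 0 with rfl | hz
  · obtain ⟨e, he⟩ := exists_norm_eq V zero_le_one
    exact ⟨e, 0, he, by simp, by simp⟩
  · have := norm_ne_zero_iff.2 hz
    refine ⟨((‖z‖ : ℂ)⁻¹) • z, ‖z‖, ?_, by simp, ?_⟩
    · simp [norm_smul, this]
    · rw [smul_inv_smul₀ (by exact_mod_cast this)]

/-- A function on a product of an open parameter set with a ball, holomorphic on the ball and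
jointly `C^k` near the boundary of the ball, is jointly `C^k`. -/
theorem contDiffOn_prod_ball_of_contDiffOn_annulus {P V : Type u} [NormedAddCommGroup P]
    [NormedSpace ℝ P] [LocallyCompactSpace P] [NormedAddCommGroup V] [NormedSpace ℂ V]
    [LocallyCompactSpace V] [Nontrivial V] {F : Type u} [NormedAddCommGroup F] [NormedSpace ℂ F]
    [CompleteSpace F]
    {r R : ℝ} (hrR : r < R) {T : Set P} (hT : IsOpen T) {k : ℕ} {h : P → V → F}
    (hhol : ∀ t ∈ T, DifferentiableOn ℂ (h t) (ball 0 R))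
    (hreg : ContDiffOn ℝ k (fun p : P × V => h p.1 p.2) (T ×ˢ {z | r < ‖z‖ ∧ ‖z‖ < R})) :
    ContDiffOn ℝ k (fun p : P × V => h p.1 p.2) (T ×ˢ ball 0 R) := by
  rintro ⟨t₀, z₀⟩ ⟨ht₀, hz₀⟩
  obtain ⟨e, c, he, hc, rfl⟩ := exists_norm_eq_one_smul_eq z₀
  rw [mem_ball_zero_iff, ← hc] at hz₀
  obtain ⟨s, hs, hsR⟩ := exists_between (max_lt hrR hz₀)
  obtain ⟨hrs, hcs⟩ := max_lt_iff.1 hs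
  have hs0 : 0 < s := (norm_nonneg c).trans_lt hcs
  set δ := min (s - r) (R - s)
  have hδ : 0 < δ := lt_min (sub_pos.2 hrs) (sub_pos.2 hsR)
  set U : Set (P × V) := T ×ˢ ball (c • e) δ
  have hU : IsOpen U := hT.prod isOpen_ball
  have hball : ∀ z ∈ ball (c • e) δ, ‖z - c • e‖ < s - r ∧ ‖z - c • e‖ < R - s := fun z hz => by
    rw [mem_ball_iff_norm] at hz
    exact lt_min_iff.1 hz
  have hint : ContDiffOn ℝ k (fun q : (P × V) × ℝ =>
      (deriv (circleMap 0 s) q.2 * (circleMap 0 s q.2 - c)⁻¹) •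
        h q.1.1 (q.1.2 - c • e + circleMap 0 s q.2 • e)) (U ×ˢ univ) := by
    have hker : ContDiff ℝ k fun θ : ℝ => deriv (circleMap 0 s) θ * (circleMap 0 s θ - c)⁻¹ := by
      simp only [deriv_circleMap]
      refine ((contDiff_circleMap 0 s).mul contDiff_const).mul
        (((contDiff_circleMap 0 s).sub contDiff_const).inv fun θ => ?_)
      exact sub_ne_zero.2 (circleMap_ne_mem_ball (by simpa using hcs) θ)
    refine (hker.comp contDiff_snd).contDiffOn.smul ?_
    have hmap : ContDiff ℝ k fun q : (P × V) × ℝ =>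
        (q.1.1, q.1.2 - c • e + circleMap 0 s q.2 • e) :=
      (contDiff_fst.comp contDiff_fst).prodMk <|
        ((contDiff_snd.comp contDiff_fst).sub contDiff_const).add <|
          ((contDiff_circleMap 0 s).comp contDiff_snd).smul contDiff_const
    refine hreg.comp hmap.contDiffOn ?_
    rintro ⟨⟨t, z⟩, θ⟩ ⟨⟨ht, hz⟩, -⟩
    have hnorm : ‖circleMap 0 s θ • e‖ = s := by simp [norm_smul, he, abs_of_pos hs0]
    obtain ⟨h₁, h₂⟩ := hball z hz
    have h₃ := norm_add_le (z - c • e) (circleMap 0 s θ • e)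
    have h₄ := norm_sub_le (z - c • e + circleMap 0 s θ • e) (z - c • e)
    rw [add_sub_cancel_left] at h₄
    exact ⟨ht, by simp only; linarith, by simp only; linarith⟩
  have hcauchy : ∀ p ∈ U, h p.1 p.2 = (2 * Real.pi * Complex.I : ℂ)⁻¹ •
      ∫ θ in (0 : ℝ)..2 * Real.pi, (deriv (circleMap 0 s) θ * (circleMap 0 s θ - c)⁻¹) •
        h p.1 (p.2 - c • e + circleMap 0 s θ • e) := by
    rintro ⟨t, z⟩ ⟨ht, hz⟩
    have hd : DifferentiableOn ℂ (fun ζ : ℂ => h t (z - c • e + ζ • e)) (closedBall 0 s) := by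
      refine (hhol t ht).comp (by fun_prop) fun ζ hζ => ?_
      rw [mem_closedBall_zero_iff] at hζ
      rw [mem_ball_zero_iff]
      have := norm_add_le (z - c • e) (ζ • e)
      rw [norm_smul, he, mul_one] at this
      linarith [(hball z hz).2]
    have hformula := hd.circleIntegral_sub_inv_smul (w := c) (by simpa using hcs)
    rw [circleIntegral] at hformula
    simp only [smul_smul, sub_add_cancel] at hformula
    simp only [hformula]
    rw [inv_smul_smul₀ Complex.two_pi_I_ne_zero]
  have hloc : ContDiffOn ℝ k (fun p : P × V => h p.1 p.2) U :=
    ((contDiffOn_parametric_intervalIntegral hU 0 (2 * Real.pi) k hint).const_smul _).congr hcauchy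
  exact (hloc.contDiffAt (hU.mem_nhds ⟨ht₀, mem_ball_self hδ⟩)).contDiffWithinAt

/-- Let `0 < r < R`, `I = (a,b)` an open interval, `B` the ball of radius `R`
in `ℂⁿ` and `A` the annulus `{r < ‖z‖ < R}`. If `h(t,·)` is holomorphic on `B` for each
`t ∈ I` and `h` is jointly `C^k` (in the real sense) on `I × A`, then `h` is jointly `C^k`
on `I × B`. -/
theorem stmt2 (n : ℕ) (hn : 1 ≤ n) (r R : ℝ) (hr : 0 < r) (hrR : r < R)
    (a b : ℝ) (k : ℕ)
    (h : ℝ → EuclideanSpace ℂ (Fin n) → ℂ)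
    (hhol : ∀ t ∈ Set.Ioo a b,
      DifferentiableOn ℂ (h t) (Metric.ball (0 : EuclideanSpace ℂ (Fin n)) R))
    (hreg : ContDiffOn ℝ k (fun p : ℝ × EuclideanSpace ℂ (Fin n) => h p.1 p.2)
      (Set.Ioo a b ×ˢ {z : EuclideanSpace ℂ (Fin n) | r < ‖z‖ ∧ ‖z‖ < R})) :
    ContDiffOn ℝ k (fun p : ℝ × EuclideanSpace ℂ (Fin n) => h p.1 p.2)
      (Set.Ioo a b ×ˢ Metric.ball (0 : EuclideanSpace ℂ (Fin n)) R) := by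
  have : Nontrivial (EuclideanSpace ℂ (Fin n)) := by
    have : Nonempty (Fin n) := ⟨⟨0, hn⟩⟩
    infer_instance
  exact contDiffOn_prod_ball_of_contDiffOn_annulus hrR isOpen_Ioo hhol hreg
end

section
/- Let Ω ⊆ ℂⁿ be open, I ⊆ ℝ be open, and let k be a natural number. Let h : I × Ω → ℂ be continuous and such that for each fixed t ∈ I the map z ↦ h(t,z) is holomorphic on Ω. Suppose that for every m with 1 ≤ m ≤ k, the m-th order partial derivative ∂^m h/∂t^m exists at every point of I × Ω and is continuous on I × Ω. Then h is C^k on I × Ω, i.e., h is k times continuously (real-)differentiable jointly in (t,z). -/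
open Set Filter Metric Topology

/-- A family which is jointly continuous near `(t, x)` converges uniformly, as the parameter tends
to `t`, on a small ball around `x` contained in a given neighborhood. -/
theorem ContinuousOn.exists_tendstoUniformlyOn_ball {T E F : Type*} [UniformSpace T]
    [LocallyCompactSpace T] [PseudoMetricSpace E] [ProperSpace E] [UniformSpace F] {h : T → E → F} {I : Set T} {Ω : Set E} {t : T} {x : E}
    (hI : I ∈ 𝓝 t) (hΩ : Ω ∈ 𝓝 x)
    (hc : ContinuousOn (fun p : T × E => h p.1 p.2) (I ×ˢ Ω)) :
    ∃ R > 0, ball x R ⊆ Ω ∧ TendstoUniformlyOn h (h t) (𝓝 t) (ball x R) := by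
  obtain ⟨K, hK, hKI, hKc⟩ := local_compact_nhds hI
  obtain ⟨R, hR, hRΩ⟩ := nhds_basis_closedBall.mem_iff.mp hΩ
  refine ⟨R, hR, ball_subset_closedBall.trans hRΩ, ?_⟩
  have hu : UniformContinuousOn (fun p : T × E => h p.1 p.2) (K ×ˢ closedBall x R) :=
    (hKc.prod (isCompact_closedBall x R)).uniformContinuousOn_of_continuous
      (hc.mono (prod_mono hKI hRΩ))
  have := UniformContinuousOn.tendstoUniformlyOn (F := h) hu (mem_of_mem_nhds hK)
  rw [nhdsWithin_eq_nhds.mpr hK] at this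
  exact this.mono ball_subset_closedBall

section HolomorphicFamilies

variable {E F : Type*} [NormedAddCommGroup E] [NormedSpace ℂ E]
  [NormedAddCommGroup F] [NormedSpace ℂ F]

/-- A Cauchy estimate: the derivative of a holomorphic function bounded by `C` on a ball of radius
`R` is at most `2 * C / R` at the center. -/
theorem norm_fderiv_le_of_norm_le_on_ball {f : E → F} {x : E} {R C : ℝ} (hR : 0 < R)
    (hf : DifferentiableOn ℂ f (ball x R)) (hC : ∀ y ∈ ball x R, ‖f y‖ ≤ C) :
    ‖fderiv ℂ f x‖ ≤ 2 * C / R := by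
  refine Complex.norm_fderiv_le_div_of_mapsTo_ball hf (fun y hy => ?_) hR
  rw [mem_closedBall, dist_eq_norm]
  linarith [norm_sub_le (f y) (f x), hC y hy, hC x (mem_ball_self hR)]

/-- A uniform limit of holomorphic functions on a ball is holomorphic at the center, and its
derivative there is the limit of the derivatives. -/
theorem TendstoUniformlyOn.differentiableAt_and_tendsto_fderiv [CompleteSpace F] {ι : Type*}
    {l : Filter ι} [l.NeBot] {f : ι → E → F} {g : E → F} {x : E} {R : ℝ} (hR : 0 < R)
    (hf : ∀ᶠ n in l, DifferentiableOn ℂ (f n) (ball x R))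
    (hfg : TendstoUniformlyOn f g l (ball x R)) :
    DifferentiableAt ℂ g x ∧ Tendsto (fun n => fderiv ℂ (f n) x) l (𝓝 (fderiv ℂ g x)) := by
  have hR2 : 0 < R / 2 := half_pos hR
  have hball : ∀ y ∈ ball x (R / 2), ball y (R / 2) ⊆ ball x R := fun y hy =>
    ball_subset_ball' (by linarith [mem_ball.mp hy])
  have hcauchy : UniformCauchySeqOn (fun n => fderiv ℂ (f n)) l (ball x (R / 2)) := by
    intro u hu
    obtain ⟨ε, hε, hεu⟩ := Metric.mem_uniformity_dist.mp hu
    have hC : 0 < ε * R / 8 := by positivity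
    filter_upwards [hfg.uniformCauchySeqOn _ (dist_mem_uniformity hC),
      hf.prod_mk hf] with n hn hd y hy
    apply hεu
    have hnhds := ball_mem_nhds y hR2
    have hd1 := hd.1.mono (hball y hy)
    have hd2 := hd.2.mono (hball y hy)
    have key := norm_fderiv_le_of_norm_le_on_ball (f := f n.1 - f n.2) (C := ε * R / 8) hR2
      (hd1.sub hd2) (fun z hz => by
        simpa [dist_eq_norm] using (hn z (hball y hy hz)).le)
    rw [fderiv_sub (hd1.differentiableAt hnhds) (hd2.differentiableAt hnhds)] at key
    rw [dist_eq_norm]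
    refine key.trans_lt ?_
    field_simp
    linarith
  have hlim : ∀ y ∈ ball x (R / 2), ∃ L, Tendsto (fun n => fderiv ℂ (f n) y) l (𝓝 L) :=
    fun y hy => cauchy_map_iff_exists_tendsto.mp (hcauchy.cauchy_map hy)
  choose! g' hg' using hlim
  have hx : ball x (R / 2) ∈ 𝓝 x := ball_mem_nhds x hR2
  have hfderiv : HasFDerivAt g (g' x) x := by
    refine hasFDerivAt_of_tendstoUniformlyOnFilter (f := f) (f' := fun n => fderiv ℂ (f n))
      (l := l) ?_ ?_ ?_
    · exact (hcauchy.tendstoUniformlyOn_of_tendsto hg').tendstoUniformlyOnFilter.mono_right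
        (le_principal_iff.mpr hx)
    · filter_upwards [hf.prod_mk (ball_mem_nhds x hR)] with p hp
      exact (hp.1.differentiableAt (isOpen_ball.mem_nhds hp.2)).hasFDerivAt
    · filter_upwards [ball_mem_nhds x hR] with y hy using hfg.tendsto_at hy
  exact ⟨hfderiv.differentiableAt, hfderiv.fderiv ▸ hg' x (mem_ball_self hR2)⟩

/-- The derivative in `z` of a jointly continuous family of holomorphic functions is jointly
continuous. -/
theorem continuousOn_fderiv_of_continuousOn [ProperSpace E] [CompleteSpace F]
    {T : Type*} [UniformSpace T] [LocallyCompactSpace T] {h : T → E → F} {I : Set T} {Ω : Set E}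
    (hI : IsOpen I) (hΩ : IsOpen Ω)
    (hc : ContinuousOn (fun p : T × E => h p.1 p.2) (I ×ˢ Ω))
    (hd : ∀ t ∈ I, DifferentiableOn ℂ (h t) Ω) :
    ContinuousOn (fun p : T × E => fderiv ℂ (h p.1) p.2) (I ×ˢ Ω) := by
  rintro ⟨t, x⟩ ⟨ht, hx⟩
  refine ContinuousAt.continuousWithinAt ?_
  -- translate, so that the base point becomes part of the parameter
  let H : T × E → E → F := fun q z => h q.1 (z + (q.2 - x))
  obtain ⟨r, hr, hrΩ⟩ := Metric.isOpen_iff.mp hΩ x hx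
  have hmem : ∀ z ∈ ball x (r / 2), ∀ w ∈ ball x (r / 2), z + (w - x) ∈ Ω := by
    intro z hz w hw
    apply hrΩ
    rw [mem_ball, dist_eq_norm] at *
    calc ‖z + (w - x) - x‖ = ‖(z - x) + (w - x)‖ := by congr 1; abel
      _ < r := by linarith [norm_add_le (z - x) (w - x)]
  have hr2 : 0 < r / 2 := half_pos hr
  have hJ : I ×ˢ ball x (r / 2) ∈ 𝓝 (t, x) :=
    prod_mem_nhds (hI.mem_nhds ht) (ball_mem_nhds x hr2)
  have hH : ContinuousOn (fun p : (T × E) × E => H p.1 p.2)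
      ((I ×ˢ ball x (r / 2)) ×ˢ ball x (r / 2)) := by
    refine hc.comp (f := fun p : (T × E) × E => (p.1.1, p.2 + (p.1.2 - x)))
      (by fun_prop) ?_
    rintro ⟨⟨s, w⟩, z⟩ ⟨⟨hs, hw⟩, hz⟩
    exact ⟨hs, hmem z hz w hw⟩
  obtain ⟨R, hR, hRr, hu⟩ := hH.exists_tendstoUniformlyOn_ball hJ (ball_mem_nhds x hr2)
  have hdiff : ∀ᶠ q in 𝓝 (t, x), DifferentiableOn ℂ (H q) (ball x R) := by
    filter_upwards [hJ] with q hq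
    exact (hd q.1 hq.1).comp (f := fun z => z + (q.2 - x)) (by fun_prop)
      (fun z hz => hmem z (hRr hz) q.2 hq.2)
  have := (hu.differentiableAt_and_tendsto_fderiv hR hdiff).2
  simpa [ContinuousAt, H, fderiv_comp_add_right] using this

/-- If `h` is holomorphic in `z` and differentiable in the real variable `t` with jointly continuous
derivative `h'`, then `h'` is holomorphic in `z` and the derivatives in `t` and `z` commute. -/
theorem differentiableOn_and_hasDerivAt_fderiv [ProperSpace E] [CompleteSpace F]
    {h h' : ℝ → E → F} {I : Set ℝ} {Ω : Set E} (hI : IsOpen I) (hΩ : IsOpen Ω)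
    (hd : ∀ t ∈ I, DifferentiableOn ℂ (h t) Ω)
    (hh' : ∀ t ∈ I, ∀ z ∈ Ω, HasDerivAt (fun s => h s z) (h' t z) t)
    (hc : ContinuousOn (fun p : ℝ × E => h' p.1 p.2) (I ×ˢ Ω)) {t : ℝ} (ht : t ∈ I) :
    DifferentiableOn ℂ (h' t) Ω ∧
      ∀ z ∈ Ω, HasDerivAt (fun s => fderiv ℂ (h s) z) (fderiv ℂ (h' t) z) t := by
  suffices H : ∀ x ∈ Ω, DifferentiableAt ℂ (h' t) x ∧
      HasDerivAt (fun s => fderiv ℂ (h s) x) (fderiv ℂ (h' t) x) t from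
    ⟨fun x hx => (H x hx).1.differentiableWithinAt, fun x hx => (H x hx).2⟩
  intro x hx
  obtain ⟨R, hR, hRΩ, hu⟩ :=
    hc.exists_tendstoUniformlyOn_ball (hI.mem_nhds ht) (hΩ.mem_nhds hx)
  have hslope : TendstoUniformlyOn (fun s z => (s - t)⁻¹ • (h s z - h t z)) (h' t)
      (𝓝[≠] t) (ball x R) := by
    rw [Metric.tendstoUniformlyOn_iff] at hu ⊢
    intro ε hε
    obtain ⟨δ, hδ, hδI⟩ := Metric.mem_nhds_iff.mp
      (inter_mem (hu (ε / 2) (half_pos hε)) (hI.mem_nhds ht))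
    filter_upwards [self_mem_nhdsWithin, mem_nhdsWithin_of_mem_nhds (ball_mem_nhds t hδ)]
      with s hst hs z hz
    have hst' : 0 < ‖s - t‖ := norm_pos_iff.mpr (sub_ne_zero.mpr hst)
    have hmv := (convex_ball t δ).norm_image_sub_le_of_norm_hasDerivWithin_le
      (f := fun s => h s z - s • h' t z) (f' := fun s => h' s z - h' t z) (C := ε / 2)
      (fun s hs => by
        simpa using ((hh' s (hδI hs).2 z (hRΩ hz)).fun_sub
          ((hasDerivAt_id s).smul_const (h' t z))).hasDerivWithinAt)
      (fun s hs => by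
        have : dist (h' t z) (h' s z) < ε / 2 := (hδI hs).1 z hz
        rw [dist_comm, dist_eq_norm] at this
        exact this.le)
      (mem_ball_self hδ) hs
    rw [dist_comm, dist_eq_norm]
    have heq : (s - t)⁻¹ • (h s z - h t z) - h' t z =
        (s - t)⁻¹ • ((h s z - s • h' t z) - (h t z - t • h' t z)) := by
      have : (s - t)⁻¹ • ((s - t) • h' t z) = h' t z :=
        inv_smul_smul₀ (sub_ne_zero.mpr hst) _
      conv_lhs => rw [← this]
      rw [← smul_sub, sub_smul]
      congr 1
      abel
    rw [heq, norm_smul, norm_inv, inv_mul_lt_iff₀ hst']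
    nlinarith
  have hdiff : ∀ᶠ s in 𝓝[≠] t,
      DifferentiableOn ℂ (fun z => (s - t)⁻¹ • (h s z - h t z)) (ball x R) := by
    filter_upwards [mem_nhdsWithin_of_mem_nhds (hI.mem_nhds ht)] with s hs
    exact (((hd s hs).sub (hd t ht)).const_smul (s - t)⁻¹).mono hRΩ
  obtain ⟨hdx, hlim⟩ := hslope.differentiableAt_and_tendsto_fderiv hR hdiff
  refine ⟨hdx, hasDerivAt_iff_tendsto_slope.mpr (hlim.congr' ?_)⟩
  filter_upwards [mem_nhdsWithin_of_mem_nhds (hI.mem_nhds ht)] with s hs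
  have hs' := (hd s hs).differentiableAt (hΩ.mem_nhds hx)
  have ht' := (hd t ht).differentiableAt (hΩ.mem_nhds hx)
  rw [slope_def_module, ← fderiv_fun_sub hs' ht', ← fderiv_const_smul (hs'.fun_sub ht')]
  rfl

/-- Directional derivatives of a holomorphic function are holomorphic. -/
theorem DifferentiableOn.fderiv_apply_of_isOpen [ProperSpace E] [CompleteSpace F] {f : E → F}
    {Ω : Set E} (hΩ : IsOpen Ω) (hf : DifferentiableOn ℂ f Ω) (w : E) :
    DifferentiableOn ℂ (fun z => fderiv ℂ f z w) Ω := by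
  intro x hx
  refine DifferentiableAt.differentiableWithinAt ?_
  have hf' : ContinuousOn (fderiv ℂ f) Ω := by
    have := continuousOn_fderiv_of_continuousOn (T := ℝ) (h := fun _ => f) isOpen_univ hΩ
      (hf.continuousOn.comp continuousOn_snd (fun p hp => hp.2)) (fun _ _ => hf)
    exact this.comp (f := fun z => ((0 : ℝ), z)) (by fun_prop) (fun z hz => ⟨mem_univ _, hz⟩)
  have hcont : Continuous fun p : ℝ × E => p.2 + p.1 • w := by fun_prop
  have hnhds : (fun p : ℝ × E => p.2 + p.1 • w) ⁻¹' Ω ∈ 𝓝 ((0 : ℝ), x) :=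
    (hΩ.preimage hcont).mem_nhds (by simpa using hx)
  obtain ⟨I, Ω', hI, h0, hΩ', hx', hsub⟩ := mem_nhds_prod_iff'.mp hnhds
  have := (differentiableOn_and_hasDerivAt_fderiv (h := fun s z => f (z + s • w))
    (h' := fun s z => fderiv ℂ f (z + s • w) w) hI hΩ'
    (fun s hs => hf.comp (by fun_prop) (fun z hz => hsub (mk_mem_prod hs hz)))
    (fun s hs z hz => by
      have hfz := (hf.differentiableAt
        (hΩ.mem_nhds (hsub (mk_mem_prod hs hz)))).hasFDerivAt.restrictScalars ℝ
      have hline : HasDerivAt (fun s : ℝ => z + s • w) w s := by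
        simpa using ((hasDerivAt_id s).smul_const w).const_add z
      exact hfz.comp_hasDerivAt s hline)
    ((hf'.comp hcont.continuousOn hsub).clm_apply continuousOn_const) h0).1
  simpa using this.differentiableAt (hΩ'.mem_nhds hx')

/-- A family of holomorphic functions whose pure `t`-derivatives `g m`, `m ≤ k`, are jointly
continuous is jointly `C^k`. -/
theorem contDiffOn_of_holomorphic_of_continuousOn_deriv [FiniteDimensional ℂ E] [CompleteSpace F]
    {I : Set ℝ} {Ω : Set E} (hI : IsOpen I) (hΩ : IsOpen Ω) (k : ℕ) (g : ℕ → ℝ → E → F)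
    (hd : ∀ t ∈ I, DifferentiableOn ℂ (g 0 t) Ω)
    (hc : ∀ m ≤ k, ContinuousOn (fun p : ℝ × E => g m p.1 p.2) (I ×ˢ Ω))
    (hg : ∀ m < k, ∀ t ∈ I, ∀ z ∈ Ω, HasDerivAt (fun s => g m s z) (g (m + 1) t z) t) :
    ContDiffOn ℝ k (fun p : ℝ × E => g 0 p.1 p.2) (I ×ˢ Ω) := by
  have : ProperSpace E := FiniteDimensional.proper ℂ E
  have : FiniteDimensional ℝ E := FiniteDimensional.complexToReal E
  induction k generalizing g with
  | zero => simpa using hc 0 le_rfl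
  | succ k ih =>
    have hdm : ∀ m ≤ k + 1, ∀ t ∈ I, DifferentiableOn ℂ (g m t) Ω := by
      intro m
      induction m with
      | zero => exact fun _ => hd
      | succ m ihm =>
        exact fun hm t ht => (differentiableOn_and_hasDerivAt_fderiv hI hΩ (ihm (by omega))
          (hg m (by omega)) (hc (m + 1) hm) ht).1
    have hfd : ∀ m ≤ k + 1,
        ContinuousOn (fun p : ℝ × E => fderiv ℂ (g m p.1) p.2) (I ×ˢ Ω) := fun m hm =>
      continuousOn_fderiv_of_continuousOn hI hΩ (hc m hm) (hdm m hm)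
    have htime : ContDiffOn ℝ k (fun p : ℝ × E => g 1 p.1 p.2) (I ×ˢ Ω) :=
      ih (fun m => g (m + 1)) (hdm 1 (by omega)) (fun m hm => hc (m + 1) (by omega))
        (fun m hm => hg (m + 1) (by omega))
    have hspace : ContDiffOn ℝ k
        (fun p : ℝ × E => (fderiv ℂ (g 0 p.1) p.2).restrictScalars ℝ) (I ×ˢ Ω) := by
      refine contDiffOn_clm_apply.mpr fun w => ?_
      refine ih (fun m t z => fderiv ℂ (g m t) z w)
        (fun t ht => (hd t ht).fderiv_apply_of_isOpen hΩ w)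
        (fun m hm => (hfd m (by omega)).clm_apply continuousOn_const) (fun m hm t ht z hz => ?_)
      have := (differentiableOn_and_hasDerivAt_fderiv hI hΩ (hdm m (by omega))
          (hg m (by omega)) (hc (m + 1) (by omega)) ht).2 z hz
      exact ((ContinuousLinearMap.apply ℂ F w).restrictScalars ℝ).hasFDerivAt.comp_hasDerivAt t this
    let G' : ℝ × E → ℝ × E →L[ℝ] F := fun p =>
      (ContinuousLinearMap.toSpanSingleton ℝ (g 1 p.1 p.2)).coprod
        ((fderiv ℂ (g 0 p.1) p.2).restrictScalars ℝ)
    have hopen : IsOpen (I ×ˢ Ω) := hI.prod hΩ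
    have hG'₁ : ContDiffOn ℝ k (fun p : ℝ × E =>
        ContinuousLinearMap.toSpanSingleton ℝ (g 1 p.1 p.2)) (I ×ˢ Ω) :=
      contDiffOn_clm_apply.mpr fun c => by
        simpa using htime.const_smul c
    have hG' : ContDiffOn ℝ k G' (I ×ˢ Ω) := by
      refine contDiffOn_clm_apply.mpr fun v => ?_
      simpa [G'] using (htime.const_smul v.1).add (hspace.clm_apply contDiffOn_const)
    have hderiv : ∀ p ∈ I ×ˢ Ω, HasFDerivAt (fun p : ℝ × E => g 0 p.1 p.2) (G' p) p := by
      intro p hp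
      refine (hasStrictFDerivAt_uncurry_coprod (f := g 0)
        (f₁ := fun t z => ContinuousLinearMap.toSpanSingleton ℝ (g 1 t z))
        (f₂ := fun t z => (fderiv ℂ (g 0 t) z).restrictScalars ℝ) ?_ ?_ ?_ ?_).hasFDerivAt
      · filter_upwards [hopen.mem_nhds hp] with q hq
        exact (hg 0 (by omega) q.1 hq.1 q.2 hq.2).hasFDerivAt
      · filter_upwards [hopen.mem_nhds hp] with q hq
        exact ((hd q.1 hq.1).differentiableAt
          (hΩ.mem_nhds hq.2)).hasFDerivAt.restrictScalars ℝ
      · exact hG'₁.continuousOn.continuousAt (hopen.mem_nhds hp)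
      · exact hspace.continuousOn.continuousAt (hopen.mem_nhds hp)
    push_cast
    refine (contDiffOn_succ_iff_fderiv_of_isOpen hopen).mpr
      ⟨fun p hp => (hderiv p hp).differentiableAt.differentiableWithinAt, by simp, ?_⟩
    exact hG'.congr fun p hp => (hderiv p hp).fderiv

end HolomorphicFamilies

/-- Let `Ω ⊆ ℂⁿ` and `I ⊆ ℝ` be open, `k : ℕ`. Suppose `h` is continuous on
`I × Ω`, holomorphic in `z` for each fixed `t ∈ I`, and for every `1 ≤ m ≤ k` the `m`-th
pure `t`-derivative `∂^m h/∂t^m` exists at every point of `I × Ω` (i.e. the `(m-1)`-st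
iterated `t`-derivative is differentiable in `t`) and is continuous on `I × Ω`. Then `h`
is jointly `C^k` (in the real sense) on `I × Ω`. -/
theorem stmt3 (n : ℕ) (Ω : Set (EuclideanSpace ℂ (Fin n))) (I : Set ℝ)
    (hΩ : IsOpen Ω) (hI : IsOpen I) (k : ℕ)
    (h : ℝ → EuclideanSpace ℂ (Fin n) → ℂ)
    (hcont : ContinuousOn (fun p : ℝ × EuclideanSpace ℂ (Fin n) => h p.1 p.2) (I ×ˢ Ω))
    (hhol : ∀ t ∈ I, DifferentiableOn ℂ (h t) Ω)
    (hderiv : ∀ m : ℕ, 1 ≤ m → m ≤ k →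
      (∀ z ∈ Ω, ∀ t ∈ I,
        DifferentiableAt ℝ (iteratedDeriv (m - 1) (fun s => h s z)) t) ∧
      ContinuousOn
        (fun p : ℝ × EuclideanSpace ℂ (Fin n) => iteratedDeriv m (fun s => h s p.2) p.1)
        (I ×ˢ Ω)) :
    ContDiffOn ℝ k (fun p : ℝ × EuclideanSpace ℂ (Fin n) => h p.1 p.2) (I ×ˢ Ω) := by
  refine contDiffOn_of_holomorphic_of_continuousOn_deriv hI hΩ k
    (fun m t z => iteratedDeriv m (fun s => h s z) t) (by simpa using hhol) (fun m hm => ?_)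
    (fun m hm t ht z hz => ?_)
  · rcases m.eq_zero_or_pos with rfl | hpos
    · simpa using hcont
    · exact (hderiv m hpos hm).2
  · simpa [iteratedDeriv_succ] using ((hderiv (m + 1) (by omega) hm).1 z hz t ht).hasDerivAt
end

section
/- Let R > 0, let I ⊆ ℝ be open, and let h : I × {ξ ∈ ℂ : |ξ| ≤ R} → ℂ be continuous, with z ↦ h(t,z) holomorphic on the open disc {|z| < R} for each t ∈ I. Suppose there is a continuous function g : I × {ξ : |ξ| = R} → ℂ such that for every t ∈ I and every ξ with |ξ| = R, the map s ↦ h(s,ξ) is differentiable at t with derivative g(t,ξ). Then for every z with |z| < R, the map t ↦ h(t,z) is differentiable on I, and its derivative is ∂h/∂t(t,z) = (1/(2πi)) ∮_{|ξ|=R} g(t,ξ)/(ξ − z) dξ. -/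
open Complex

/-- Differentiation under the circle integral sign with respect to a real parameter, when the
partial derivative is jointly continuous. -/
theorem hasDerivAt_circleIntegral_of_continuousOn {E : Type*} [NormedAddCommGroup E]
    [NormedSpace ℂ E] {c : ℂ} {R : ℝ} (hR : 0 ≤ R) {I : Set ℝ} (hI : IsOpen I)
    {F F' : ℝ → ℂ → E} (hF : ∀ t ∈ I, ContinuousOn (F t) (Metric.sphere c R))
    (hF' : ContinuousOn (fun p : ℝ × ℂ => F' p.1 p.2) (I ×ˢ Metric.sphere c R))
    (hderiv : ∀ t ∈ I, ∀ ξ ∈ Metric.sphere c R, HasDerivAt (fun s => F s ξ) (F' t ξ) t)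
    {t : ℝ} (ht : t ∈ I) :
    HasDerivAt (fun s => ∮ ξ in C(c, R), F s ξ) (∮ ξ in C(c, R), F' t ξ) t := by
  obtain ⟨ε, hε, hεI⟩ := Metric.nhds_basis_closedBall.mem_iff.1 (hI.mem_nhds ht)
  obtain ⟨C, hC⟩ := ((isCompact_closedBall t ε).prod
    (isCompact_sphere c R)).exists_bound_of_continuousOn (hF'.mono (Set.prod_mono_left hεI))
  have hcirc : ∀ {f : ℂ → E}, ContinuousOn f (Metric.sphere c R) →
      Continuous fun θ => deriv (circleMap c R) θ • f (circleMap c R θ) := fun hf => by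
    simp only [deriv_circleMap]
    exact (by fun_prop : Continuous fun θ => circleMap 0 R θ * Complex.I).smul
      (hf.comp_continuous (continuous_circleMap c R) fun θ => circleMap_mem_sphere c hR θ)
  have hF't : ContinuousOn (F' t) (Metric.sphere c R) :=
    hF'.comp (f := fun ξ => (t, ξ)) (by fun_prop) fun ξ hξ => ⟨ht, hξ⟩
  refine (intervalIntegral.hasDerivAt_integral_of_dominated_loc_of_deriv_le
    (F' := fun s θ => deriv (circleMap c R) θ • F' s (circleMap c R θ))
    (bound := fun _ => R * C) (Metric.closedBall_mem_nhds t hε) ?_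
    ((hcirc (hF t ht)).intervalIntegrable _ _) (hcirc hF't).aestronglyMeasurable
    (.of_forall fun θ _ s hs => ?_) intervalIntegrable_const
    (.of_forall fun θ _ s hs => ?_)).2
  · filter_upwards [hI.mem_nhds ht] with s hs
    exact (hcirc (hF s hs)).aestronglyMeasurable
  · rw [norm_smul, deriv_circleMap, norm_mul, norm_I, mul_one, norm_circleMap_zero,
      abs_of_nonneg hR]
    exact mul_le_mul_of_nonneg_left (hC (s, _) ⟨hs, circleMap_mem_sphere c hR θ⟩) hR
  · exact (hderiv s (hεI hs) _ (circleMap_mem_sphere c hR θ)).const_smul _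

/-- Let `R > 0`, `I ⊆ ℝ` open, `h` continuous on `I × closedBall 0 R` and
holomorphic in `z` on the open disc for each `t ∈ I`. If there is a continuous
`g : I × sphere 0 R → ℂ` such that `s ↦ h(s,ξ)` is differentiable at each `t ∈ I` with
derivative `g(t,ξ)` for each `ξ` on the boundary circle, then for every `|z| < R` the map
`t ↦ h(t,z)` is differentiable on `I` with derivative
`(2πi)⁻¹ ∮_{|ξ|=R} g(t,ξ)/(ξ−z) dξ`. -/
theorem stmt4 (R : ℝ) (hR : 0 < R) (I : Set ℝ) (hI : IsOpen I)
    (h g : ℝ → ℂ → ℂ)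
    (hcont : ContinuousOn (fun p : ℝ × ℂ => h p.1 p.2) (I ×ˢ Metric.closedBall (0 : ℂ) R))
    (hhol : ∀ t ∈ I, DifferentiableOn ℂ (h t) (Metric.ball (0 : ℂ) R))
    (hgcont : ContinuousOn (fun p : ℝ × ℂ => g p.1 p.2) (I ×ˢ Metric.sphere (0 : ℂ) R))
    (hderiv : ∀ t ∈ I, ∀ ξ ∈ Metric.sphere (0 : ℂ) R,
      HasDerivAt (fun s => h s ξ) (g t ξ) t) :
    ∀ t ∈ I, ∀ z ∈ Metric.ball (0 : ℂ) R,
      HasDerivAt (fun s => h s z)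
        ((2 * Real.pi * Complex.I)⁻¹ • ∮ ξ in C(0, R), g t ξ / (ξ - z)) t := by
  intro t ht z hz
  have hne : ∀ ξ ∈ Metric.sphere (0 : ℂ) R, ξ - z ≠ 0 := by
    rintro ξ hξ h0
    rw [sub_eq_zero.1 h0] at hξ
    exact (Metric.mem_ball.1 hz).ne (Metric.mem_sphere.1 hξ)
  have hslice : ∀ s ∈ I, ContinuousOn (h s) (Metric.closedBall 0 R) := fun s hs =>
    hcont.comp (f := fun ξ => (s, ξ)) (by fun_prop) fun ξ hξ => ⟨hs, hξ⟩
  have key : HasDerivAt (fun s => ∮ ξ in C(0, R), h s ξ / (ξ - z))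
      (∮ ξ in C(0, R), g t ξ / (ξ - z)) t :=
    hasDerivAt_circleIntegral_of_continuousOn (F := fun s ξ => h s ξ / (ξ - z))
      (F' := fun s ξ => g s ξ / (ξ - z)) hR.le hI
      (fun s hs => ((hslice s hs).mono Metric.sphere_subset_closedBall).div (by fun_prop) hne)
      (hgcont.div (by fun_prop) fun p hp => hne p.2 hp.2)
      (fun s hs ξ hξ => (hderiv s hs ξ hξ).div_const _) ht
  refine (key.const_smul (2 * Real.pi * Complex.I : ℂ)⁻¹).congr_of_eventuallyEq ?_
  filter_upwards [hI.mem_nhds ht] with s hs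
  have hcauchy := circleIntegral_div_sub_of_differentiable_on_off_countable Set.countable_empty hz
    (hslice s hs) fun x hx => (hhol s hs).differentiableAt (Metric.isOpen_ball.mem_nhds hx.1)
  rw [Pi.smul_apply, hcauchy, smul_eq_mul, inv_mul_cancel_left₀ Complex.two_pi_I_ne_zero]
end

section
/- Let n ≥ 2, fix indices j ≠ k in {1,…,n} and real numbers λ_j, λ_k. For a C² function f : ℂⁿ → ℂ define the first-order operators (using Wirtinger derivatives) L f := (conj(z_k) + 2λ_k z_k)·∂f/∂z_j − (conj(z_j) + 2λ_j z_j)·∂f/∂z_k and L̄ f := (z_k + 2λ_k conj(z_k))·∂f/∂z̄_j − (z_j + 2λ_j conj(z_j))·∂f/∂z̄_k. Then for every C² function f : ℂⁿ → ℂ and every z ∈ ℂⁿ, the commutator satisfies L(L̄f)(z) − L̄(Lf)(z) = −(conj(z_j) + 2λ_j z_j)·∂f/∂z̄_j(z) − (conj(z_k) + 2λ_k z_k)·∂f/∂z̄_k(z) + (z_j + 2λ_j conj(z_j))·∂f/∂z_j(z) + (z_k + 2λ_k conj(z_k))·∂f/∂z_k(z). -/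
/-- The Wirtinger derivative `∂f/∂z_j = (1/2)(∂f/∂x_j − i ∂f/∂y_j)`. -/
noncomputable def wirtingerDeriv (n : ℕ) (j : Fin n)
    (f : EuclideanSpace ℂ (Fin n) → ℂ) (z : EuclideanSpace ℂ (Fin n)) : ℂ :=
  (1 / 2 : ℂ) * (fderiv ℝ f z (EuclideanSpace.single j 1) -
    Complex.I * fderiv ℝ f z (EuclideanSpace.single j Complex.I))

/-- The conjugate Wirtinger derivative `∂f/∂z̄_j = (1/2)(∂f/∂x_j + i ∂f/∂y_j)`. -/
noncomputable def wirtingerDerivBar (n : ℕ) (j : Fin n)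
    (f : EuclideanSpace ℂ (Fin n) → ℂ) (z : EuclideanSpace ℂ (Fin n)) : ℂ :=
  (1 / 2 : ℂ) * (fderiv ℝ f z (EuclideanSpace.single j 1) +
    Complex.I * fderiv ℝ f z (EuclideanSpace.single j Complex.I))

/-- The model CR vector field
`L f = (conj(z_k) + 2λ_k z_k) ∂f/∂z_j − (conj(z_j) + 2λ_j z_j) ∂f/∂z_k`. -/
noncomputable def Lop (n : ℕ) (j k : Fin n) (lj lk : ℝ)
    (f : EuclideanSpace ℂ (Fin n) → ℂ) : EuclideanSpace ℂ (Fin n) → ℂ :=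
  fun z => ((starRingEnd ℂ) (z k) + 2 * (lk : ℂ) * z k) * wirtingerDeriv n j f z -
    ((starRingEnd ℂ) (z j) + 2 * (lj : ℂ) * z j) * wirtingerDeriv n k f z

/-- Its conjugate
`L̄ f = (z_k + 2λ_k conj(z_k)) ∂f/∂z̄_j − (z_j + 2λ_j conj(z_j)) ∂f/∂z̄_k`. -/
noncomputable def LopBar (n : ℕ) (j k : Fin n) (lj lk : ℝ)
    (f : EuclideanSpace ℂ (Fin n) → ℂ) : EuclideanSpace ℂ (Fin n) → ℂ :=
  fun z => (z k + 2 * (lk : ℂ) * (starRingEnd ℂ) (z k)) * wirtingerDerivBar n j f z -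
    (z j + 2 * (lj : ℂ) * (starRingEnd ℂ) (z j)) * wirtingerDerivBar n k f z

theorem fderiv_coord_add_conj {n : ℕ} (l : Fin n) (a b : ℂ) (z v : EuclideanSpace ℂ (Fin n)) :
    fderiv ℝ (fun w : EuclideanSpace ℂ (Fin n) => a * w l + b * (starRingEnd ℂ) (w l)) z v =
      a * v l + b * (starRingEnd ℂ) (v l) := by
  have hproj : HasFDerivAt (fun w : EuclideanSpace ℂ (Fin n) => w l)
      ((EuclideanSpace.proj l : EuclideanSpace ℂ (Fin n) →L[ℂ] ℂ).restrictScalars ℝ) z :=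
    ((EuclideanSpace.proj l : EuclideanSpace ℂ (Fin n) →L[ℂ] ℂ).restrictScalars ℝ).hasFDerivAt
  have hconj := (Complex.conjCLE : ℂ →L[ℝ] ℂ).hasFDerivAt.comp z hproj
  have h := (hproj.const_mul a).add (hconj.const_mul b)
  exact congrArg (fun T => T v) h.fderiv

theorem differentiable_coord_add_conj {n : ℕ} (l : Fin n) (a b : ℂ) :
    Differentiable ℝ
      (fun w : EuclideanSpace ℂ (Fin n) => a * w l + b * (starRingEnd ℂ) (w l)) := by
  have hproj : Differentiable ℝ (fun w : EuclideanSpace ℂ (Fin n) => w l) :=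
    ((EuclideanSpace.proj l : EuclideanSpace ℂ (Fin n) →L[ℂ] ℂ).restrictScalars ℝ).differentiable
  have hconj : Differentiable ℝ (fun w : EuclideanSpace ℂ (Fin n) => (starRingEnd ℂ) (w l)) :=
    (Complex.conjCLE : ℂ →L[ℝ] ℂ).differentiable.comp hproj
  fun_prop

theorem differentiable_fderiv_of_contDiff_two {E F : Type*} [NormedAddCommGroup E]
    [NormedSpace ℝ E] [NormedAddCommGroup F] [NormedSpace ℝ F] {f : E → F}
    (hf : ContDiff ℝ 2 f) : Differentiable ℝ (fderiv ℝ f) :=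
  (hf.fderiv_right (m := 1) (by norm_num)).differentiable (by norm_num)

theorem wirtingerDeriv_sub {n : ℕ} (i : Fin n) {f g : EuclideanSpace ℂ (Fin n) → ℂ}
    {z : EuclideanSpace ℂ (Fin n)} (hf : DifferentiableAt ℝ f z) (hg : DifferentiableAt ℝ g z) :
    wirtingerDeriv n i (fun w => f w - g w) z = wirtingerDeriv n i f z - wirtingerDeriv n i g z := by
  simp only [wirtingerDeriv, fderiv_fun_sub hf hg, sub_apply]
  ring

theorem wirtingerDeriv_mul {n : ℕ} (i : Fin n) {f g : EuclideanSpace ℂ (Fin n) → ℂ}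
    {z : EuclideanSpace ℂ (Fin n)} (hf : DifferentiableAt ℝ f z) (hg : DifferentiableAt ℝ g z) :
    wirtingerDeriv n i (fun w => f w * g w) z =
      wirtingerDeriv n i f z * g z + f z * wirtingerDeriv n i g z := by
  simp only [wirtingerDeriv, fderiv_fun_mul hf hg, add_apply, smul_apply, smul_eq_mul]
  ring

theorem wirtingerDeriv_coord_add_conj {n : ℕ} (i l : Fin n) (a b : ℂ)
    (z : EuclideanSpace ℂ (Fin n)) :
    wirtingerDeriv n i (fun w => a * w l + b * (starRingEnd ℂ) (w l)) z =
      if l = i then a else 0 := by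
  simp only [wirtingerDeriv, fderiv_coord_add_conj, PiLp.single_apply]
  split_ifs
  · simp only [map_one, Complex.conj_I]
    linear_combination ((b - a) / 2) * Complex.I_mul_I
  · simp

theorem differentiable_wirtingerDeriv {n : ℕ} (i : Fin n) {f : EuclideanSpace ℂ (Fin n) → ℂ}
    (hf : ContDiff ℝ 2 f) : Differentiable ℝ (wirtingerDeriv n i f) := by
  have h := differentiable_fderiv_of_contDiff_two hf
  unfold wirtingerDeriv
  fun_prop

theorem wirtingerDerivBar_sub {n : ℕ} (i : Fin n) {f g : EuclideanSpace ℂ (Fin n) → ℂ}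
    {z : EuclideanSpace ℂ (Fin n)} (hf : DifferentiableAt ℝ f z) (hg : DifferentiableAt ℝ g z) :
    wirtingerDerivBar n i (fun w => f w - g w) z =
      wirtingerDerivBar n i f z - wirtingerDerivBar n i g z := by
  simp only [wirtingerDerivBar, fderiv_fun_sub hf hg, sub_apply]
  ring

theorem wirtingerDerivBar_mul {n : ℕ} (i : Fin n) {f g : EuclideanSpace ℂ (Fin n) → ℂ}
    {z : EuclideanSpace ℂ (Fin n)} (hf : DifferentiableAt ℝ f z) (hg : DifferentiableAt ℝ g z) :
    wirtingerDerivBar n i (fun w => f w * g w) z =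
      wirtingerDerivBar n i f z * g z + f z * wirtingerDerivBar n i g z := by
  simp only [wirtingerDerivBar, fderiv_fun_mul hf hg, add_apply, smul_apply, smul_eq_mul]
  ring

theorem wirtingerDerivBar_coord_add_conj {n : ℕ} (i l : Fin n) (a b : ℂ)
    (z : EuclideanSpace ℂ (Fin n)) :
    wirtingerDerivBar n i (fun w => a * w l + b * (starRingEnd ℂ) (w l)) z =
      if l = i then b else 0 := by
  simp only [wirtingerDerivBar, fderiv_coord_add_conj, PiLp.single_apply]
  split_ifs
  · simp only [map_one, Complex.conj_I]
    linear_combination ((a - b) / 2) * Complex.I_mul_I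
  · simp

theorem differentiable_wirtingerDerivBar {n : ℕ} (i : Fin n) {f : EuclideanSpace ℂ (Fin n) → ℂ}
    (hf : ContDiff ℝ 2 f) : Differentiable ℝ (wirtingerDerivBar n i f) := by
  have h := differentiable_fderiv_of_contDiff_two hf
  unfold wirtingerDerivBar
  fun_prop

/-- The Wirtinger derivatives of a `C²` function commute. -/
theorem wirtingerDeriv_wirtingerDerivBar_comm {n : ℕ} (i l : Fin n)
    {f : EuclideanSpace ℂ (Fin n) → ℂ} (hf : ContDiff ℝ 2 f) (z : EuclideanSpace ℂ (Fin n)) :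
    wirtingerDeriv n i (wirtingerDerivBar n l f) z =
      wirtingerDerivBar n l (wirtingerDeriv n i f) z := by
  have hd := differentiable_fderiv_of_contDiff_two hf
  have hsymm : IsSymmSndFDerivAt ℝ f z := hf.contDiffAt.isSymmSndFDerivAt (by simp)
  have hv (v : EuclideanSpace ℂ (Fin n)) :
      HasFDerivAt (fun w => fderiv ℝ f w v) ((fderiv ℝ (fderiv ℝ f) z).flip v) z := by
    simpa using (hd z).hasFDerivAt.clm_apply (hasFDerivAt_const v z)
  have hbar : HasFDerivAt (wirtingerDerivBar n l f) _ z :=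
    ((hv (EuclideanSpace.single l 1)).add
      ((hv (EuclideanSpace.single l Complex.I)).const_mul Complex.I)).const_mul (1 / 2 : ℂ)
  have hhol : HasFDerivAt (wirtingerDeriv n i f) _ z :=
    ((hv (EuclideanSpace.single i 1)).sub
      ((hv (EuclideanSpace.single i Complex.I)).const_mul Complex.I)).const_mul (1 / 2 : ℂ)
  rw [wirtingerDeriv, wirtingerDerivBar, hbar.fderiv, hhol.fderiv]
  simp only [smul_apply, add_apply, sub_apply, ContinuousLinearMap.flip_apply, smul_eq_mul]
  rw [hsymm.eq (EuclideanSpace.single i 1) (EuclideanSpace.single l 1),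
    hsymm.eq (EuclideanSpace.single i 1) (EuclideanSpace.single l Complex.I),
    hsymm.eq (EuclideanSpace.single i Complex.I) (EuclideanSpace.single l 1),
    hsymm.eq (EuclideanSpace.single i Complex.I) (EuclideanSpace.single l Complex.I)]
  ring

/-- For every `C²` function `f : ℂⁿ → ℂ`, the commutator `[L, L̄] f = LL̄f − L̄Lf`
equals
`−(conj(z_j)+2λ_j z_j)∂f/∂z̄_j − (conj(z_k)+2λ_k z_k)∂f/∂z̄_k
 + (z_j+2λ_j conj(z_j))∂f/∂z_j + (z_k+2λ_k conj(z_k))∂f/∂z_k`. -/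
theorem stmt10 (n : ℕ) (hn : 2 ≤ n) (j k : Fin n) (hjk : j ≠ k) (lj lk : ℝ) :
    ∀ f : EuclideanSpace ℂ (Fin n) → ℂ, ContDiff ℝ 2 f →
      ∀ z : EuclideanSpace ℂ (Fin n),
        Lop n j k lj lk (LopBar n j k lj lk f) z -
          LopBar n j k lj lk (Lop n j k lj lk f) z =
        -((starRingEnd ℂ) (z j) + 2 * (lj : ℂ) * z j) * wirtingerDerivBar n j f z -
          ((starRingEnd ℂ) (z k) + 2 * (lk : ℂ) * z k) * wirtingerDerivBar n k f z +
          (z j + 2 * (lj : ℂ) * (starRingEnd ℂ) (z j)) * wirtingerDeriv n j f z +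
          (z k + 2 * (lk : ℂ) * (starRingEnd ℂ) (z k)) * wirtingerDeriv n k f z := by
  intro f hf z
  have hL : Lop n j k lj lk f = fun w =>
      (2 * (lk : ℂ) * w k + 1 * (starRingEnd ℂ) (w k)) * wirtingerDeriv n j f w -
        (2 * (lj : ℂ) * w j + 1 * (starRingEnd ℂ) (w j)) * wirtingerDeriv n k f w := by
    funext w
    rw [Lop]
    ring
  have hLbar : LopBar n j k lj lk f = fun w =>
      (1 * w k + 2 * (lk : ℂ) * (starRingEnd ℂ) (w k)) * wirtingerDerivBar n j f w -
        (1 * w j + 2 * (lj : ℂ) * (starRingEnd ℂ) (w j)) * wirtingerDerivBar n k f w := by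
    funext w
    rw [LopBar]
    ring
  have hc (l : Fin n) (a b : ℂ) := differentiable_coord_add_conj l a b z
  have hd (i : Fin n) := differentiable_wirtingerDeriv i hf z
  have hdb (i : Fin n) := differentiable_wirtingerDerivBar i hf z
  have holo (i : Fin n) : wirtingerDeriv n i (LopBar n j k lj lk f) z =
      (if k = i then 1 else 0) * wirtingerDerivBar n j f z +
          (1 * z k + 2 * (lk : ℂ) * (starRingEnd ℂ) (z k)) *
            wirtingerDeriv n i (wirtingerDerivBar n j f) z -
        ((if j = i then 1 else 0) * wirtingerDerivBar n k f z +
          (1 * z j + 2 * (lj : ℂ) * (starRingEnd ℂ) (z j)) *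
            wirtingerDeriv n i (wirtingerDerivBar n k f) z) := by
    rw [hLbar, wirtingerDeriv_sub i ((hc _ _ _).fun_mul (hdb _)) ((hc _ _ _).fun_mul (hdb _)),
      wirtingerDeriv_mul i (hc _ _ _) (hdb _), wirtingerDeriv_mul i (hc _ _ _) (hdb _),
      wirtingerDeriv_coord_add_conj, wirtingerDeriv_coord_add_conj]
  have anti (i : Fin n) : wirtingerDerivBar n i (Lop n j k lj lk f) z =
      (if k = i then 1 else 0) * wirtingerDeriv n j f z +
          (2 * (lk : ℂ) * z k + 1 * (starRingEnd ℂ) (z k)) *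
            wirtingerDerivBar n i (wirtingerDeriv n j f) z -
        ((if j = i then 1 else 0) * wirtingerDeriv n k f z +
          (2 * (lj : ℂ) * z j + 1 * (starRingEnd ℂ) (z j)) *
            wirtingerDerivBar n i (wirtingerDeriv n k f) z) := by
    rw [hL, wirtingerDerivBar_sub i ((hc _ _ _).fun_mul (hd _)) ((hc _ _ _).fun_mul (hd _)),
      wirtingerDerivBar_mul i (hc _ _ _) (hd _), wirtingerDerivBar_mul i (hc _ _ _) (hd _),
      wirtingerDerivBar_coord_add_conj, wirtingerDerivBar_coord_add_conj]
  rw [Lop, LopBar, holo, holo, anti, anti]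
  simp only [wirtingerDeriv_wirtingerDerivBar_comm _ _ hf, if_true, if_neg hjk, if_neg hjk.symm]
  ring
end
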